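/- For every ε ∈ (0,1) there exists a constant c > 0 such that for all integers n ≥ 2, all Δ ∈ (0, 1-ε], and all integers t, m ≥ 0, the optimal success probabilities satisfy p*_{m·t + ⌈m/Δ²⌉} ≥ c·(1 − (1 − p*_t)^m). -/

import Mathlib

open scoped BigOperators

noncomputable section

/-- Probability that pulling arm `a` yields reward `r : Bool` (with `true` = reward 1),
when the best arm is `astar`: `Bernoulli ((1+Δ)/2)` if `a = astar`, else `Bernoulli ((1-Δ)/2)`. -/
def rewP (n : ℕ) (Δ : ℝ) (astar a : Fin n) (r : Bool) : ℝ :=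
  if r then (if a = astar then (1 + Δ) / 2 else (1 - Δ) / 2)
  else 1 - (if a = astar then (1 + Δ) / 2 else (1 - Δ) / 2)

/-- An interactive algorithm: for every history (recorded with the most recent pull first),
a probability distribution over the `n` arms used to draw the next pull. -/
def IsAlg (n : ℕ) (alg : List (Fin n × Bool) → Fin n → ℝ) : Prop :=
  ∀ h : List (Fin n × Bool), (∀ a, 0 ≤ alg h a) ∧ (∑ a : Fin n, alg h a) = 1

/-- Probability, conditionally on the best arm `astar`, of observing a given history
(recorded with the most recent pull first) when running the algorithm `alg`. -/
def histP (n : ℕ) (alg : List (Fin n × Bool) → Fin n → ℝ) (Δ : ℝ) (astar : Fin n) :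
    List (Fin n × Bool) → ℝ
  | [] => 1
  | (a, r) :: prev => histP n alg Δ astar prev * alg prev a * rewP n Δ astar a r

/-- The reversed history (most recent pull first) associated with a tuple of `t` pulls. -/
def hist {n t : ℕ} (h : Fin t → Fin n × Bool) : List (Fin n × Bool) :=
  (List.ofFn h).reverse

/-- Success probability `P(a_{t+1} = a*)` of an interactive algorithm after `t` rounds,
under the uniform prior on the best arm. -/
def succProb (n t : ℕ) (alg : List (Fin n × Bool) → Fin n → ℝ) (Δ : ℝ) : ℝ :=
  ((n : ℝ))⁻¹ * ∑ astar : Fin n, ∑ h : Fin t → Fin n × Bool,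
    histP n alg Δ astar (hist h) * alg (hist h) astar

/-- Mutual information (in nats) `I(a*; H_t)` accumulated by an interactive algorithm. -/
def mutualInfo (n t : ℕ) (alg : List (Fin n × Bool) → Fin n → ℝ) (Δ : ℝ) : ℝ :=
  ∑ astar : Fin n, ∑ h : Fin t → Fin n × Bool,
    ((n : ℝ))⁻¹ * histP n alg Δ astar (hist h) *
      Real.log (histP n alg Δ astar (hist h) /
        (((n : ℝ))⁻¹ * ∑ b : Fin n, histP n alg Δ b (hist h)))

/-- Optimal success probability `p*_t`. -/
def pStar (n t : ℕ) (Δ : ℝ) : ℝ :=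
  sSup {x : ℝ | ∃ alg, IsAlg n alg ∧ x = succProb n t alg Δ}

/-- Optimal mutual information `I*_t`. -/
def IStar (n t : ℕ) (Δ : ℝ) : ℝ :=
  sSup {x : ℝ | ∃ alg, IsAlg n alg ∧ x = mutualInfo n t alg Δ}

/-- Bayes-optimal value with `T` pulls left, for an unnormalized posterior `w` of the best arm. -/
def optValue (n : ℕ) (Δ : ℝ) : ℕ → (Fin n → ℝ) → ℝ
  | 0, w => ⨆ a, w a
  | T + 1, w => ⨆ a, ∑ r : Bool, optValue n Δ T (fun b => w b * rewP n Δ b a r)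

/-- `S b` is a lower bound, linear in the posterior, for the success probability that can be
guaranteed with `T` pulls when `b` is the best arm. -/
def Achievable (n : ℕ) (Δ : ℝ) (T : ℕ) (S : Fin n → ℝ) : Prop :=
  ∀ w : Fin n → ℝ, (∀ b, 0 ≤ w b) → ∑ b, w b * S b ≤ optValue n Δ T w

/-- The kernel `K b a` (probability of proposing `a` when `b` is the best arm) can be realized
using `t` pulls, before continuing with an arbitrary strategy that depends on the proposal. -/
def AchievableKernel (n : ℕ) (Δ : ℝ) (t : ℕ) (K : Fin n → Fin n → ℝ) : Prop :=
  ∀ (T : ℕ) (S : Fin n → Fin n → ℝ), (∀ a, Achievable n Δ T (S a)) →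
    Achievable n Δ (t + T) (fun b => ∑ a, K b a * S a b)

/-- Distribution of the arm drawn after `t` pulls, conditionally on the best arm `b`. -/
def algKernel (n t : ℕ) (alg : List (Fin n × Bool) → Fin n → ℝ) (Δ : ℝ) (b a : Fin n) : ℝ :=
  ∑ h : Fin t → Fin n × Bool, histP n alg Δ b (hist h) * alg (hist h) a

section Basic

variable {n : ℕ} {Δ : ℝ}

lemma rewP_nonneg (h0 : 0 ≤ Δ) (h1 : Δ ≤ 1) (b a : Fin n) (r : Bool) : 0 ≤ rewP n Δ b a r := by
  unfold rewP; split_ifs <;> linarith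

lemma sum_rewP (b a : Fin n) : ∑ r : Bool, rewP n Δ b a r = 1 := by
  simp [rewP]

lemma rewP_perm (σ : Equiv.Perm (Fin n)) (b a : Fin n) (r : Bool) :
    rewP n Δ (σ b) (σ a) r = rewP n Δ b a r := by
  simp [rewP]

lemma le_optValue_zero (w : Fin n → ℝ) (a : Fin n) : w a ≤ optValue n Δ 0 w :=
  le_ciSup (f := w) (Set.finite_range _).bddAbove a

lemma le_optValue_succ (T : ℕ) (w : Fin n → ℝ) (a : Fin n) :
    ∑ r : Bool, optValue n Δ T (fun b => w b * rewP n Δ b a r) ≤ optValue n Δ (T + 1) w :=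
  le_ciSup (f := fun a => ∑ r : Bool, optValue n Δ T (fun b => w b * rewP n Δ b a r))
    (Set.finite_range _).bddAbove a

lemma optValue_smul (T : ℕ) {c : ℝ} (hc : 0 ≤ c) (w : Fin n → ℝ) :
    optValue n Δ T (fun b => c * w b) = c * optValue n Δ T w := by
  induction T generalizing w with
  | zero => simp only [optValue, Real.mul_iSup_of_nonneg hc]
  | succ T ih =>
    simp only [optValue, Real.mul_iSup_of_nonneg hc, mul_assoc, ih, Finset.mul_sum]

lemma optValue_perm (T : ℕ) (σ : Equiv.Perm (Fin n)) (w : Fin n → ℝ) :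
    optValue n Δ T (fun b => w (σ b)) = optValue n Δ T w := by
  induction T generalizing w with
  | zero => exact σ.iSup_comp (g := w)
  | succ T ih =>
    simp only [optValue]
    rw [← σ.iSup_comp (g := fun a => ∑ r : Bool, optValue n Δ T fun b => w b * rewP n Δ b a r)]
    refine iSup_congr fun a => Finset.sum_congr rfl fun r _ => ?_
    rw [← ih (fun b => w b * rewP n Δ b (σ a) r)]
    simp only [rewP_perm]

lemma exists_maximizer [NeZero n] : ∃ best : ℕ → (Fin n → ℝ) → Fin n,
    (∀ w, optValue n Δ 0 w = w (best 0 w)) ∧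
    ∀ T w, optValue n Δ (T + 1) w =
      ∑ r : Bool, optValue n Δ T (fun b => w b * rewP n Δ b (best (T + 1) w) r) := by
  have hzero : ∀ w : Fin n → ℝ, ∃ a, w a = optValue n Δ 0 w := fun w =>
    exists_eq_ciSup_of_finite (f := w)
  have hsucc : ∀ (T : ℕ) (w : Fin n → ℝ), ∃ a,
      ∑ r : Bool, optValue n Δ T (fun b => w b * rewP n Δ b a r) = optValue n Δ (T + 1) w :=
    fun T w => exists_eq_ciSup_of_finite
      (f := fun a => ∑ r : Bool, optValue n Δ T (fun b => w b * rewP n Δ b a r))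
  choose f hf using hzero
  choose g hg using hsucc
  exact ⟨fun T => T.casesOn f g, fun w => (hf w).symm, fun T w => (hg T w).symm⟩

end Basic

section Histories

variable {n : ℕ} {Δ : ℝ} {alg : List (Fin n × Bool) → Fin n → ℝ}

lemma hist_snoc {t : ℕ} (h : Fin t → Fin n × Bool) (x : Fin n × Bool) :
    hist (Fin.snoc h x : Fin (t + 1) → Fin n × Bool) = x :: hist h := by
  simp [hist, List.ofFn_succ' (Fin.snoc h x), -List.ofFn_succ]

lemma length_hist {t : ℕ} (h : Fin t → Fin n × Bool) : (hist h).length = t := by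
  simp [hist]

lemma sum_hist_succ (t : ℕ) (f : List (Fin n × Bool) → ℝ) :
    ∑ h : Fin (t + 1) → Fin n × Bool, f (hist h) =
      ∑ h : Fin t → Fin n × Bool, ∑ a : Fin n, ∑ r : Bool, f ((a, r) :: hist h) := by
  rw [← (Fin.snocEquiv fun _ => Fin n × Bool).sum_comp, Fintype.sum_prod_type,
    Finset.sum_comm]
  refine Finset.sum_congr rfl fun h _ => ?_
  rw [← Fintype.sum_prod_type' (f := fun a r => f ((a, r) :: hist h))]
  refine Finset.sum_congr rfl fun x _ => ?_
  exact congrArg f (hist_snoc h x)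

lemma sum_hist_zero (f : List (Fin n × Bool) → ℝ) :
    ∑ h : Fin 0 → Fin n × Bool, f (hist h) = f [] := by
  simp [hist]

lemma histP_nonneg (h0 : 0 ≤ Δ) (h1 : Δ ≤ 1) (halg : IsAlg n alg) (b : Fin n)
    (h : List (Fin n × Bool)) : 0 ≤ histP n alg Δ b h := by
  induction h with
  | nil => exact zero_le_one
  | cons x h ih =>
    exact mul_nonneg (mul_nonneg ih ((halg h).1 _)) (rewP_nonneg h0 h1 _ _ _)

lemma sum_histP (halg : IsAlg n alg) (b : Fin n) (t : ℕ) :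
    ∑ h : Fin t → Fin n × Bool, histP n alg Δ b (hist h) = 1 := by
  induction t with
  | zero => exact sum_hist_zero _
  | succ t ih =>
    rw [sum_hist_succ t (fun h => histP n alg Δ b h), ← ih]
    refine Finset.sum_congr rfl fun h _ => ?_
    simp only [histP, ← Finset.mul_sum, sum_rewP, mul_one, (halg _).2]

lemma sum_algKernel (halg : IsAlg n alg) (t : ℕ) (b : Fin n) :
    ∑ a, algKernel n t alg Δ b a = 1 := by
  unfold algKernel
  rw [Finset.sum_comm, ← sum_histP (Δ := Δ) halg b t]
  exact Finset.sum_congr rfl fun h _ => by rw [← Finset.mul_sum, (halg _).2, mul_one]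

lemma succProb_eq (t : ℕ) :
    succProb n t alg Δ = (n : ℝ)⁻¹ * ∑ b, algKernel n t alg Δ b b := rfl

/-- Up to a factor not depending on the best arm, the likelihood of a history is the product of
the likelihoods of its rewards. -/
lemma exists_histP_eq (halg : IsAlg n alg) (h : List (Fin n × Bool)) :
    ∃ c : ℝ, 0 ≤ c ∧ ∀ b, histP n alg Δ b h = c * histP n (fun _ _ => 1) Δ b h := by
  induction h with
  | nil => exact ⟨1, zero_le_one, fun b => by simp [histP]⟩
  | cons x h ih =>
    obtain ⟨c, hc, heq⟩ := ih
    refine ⟨c * alg h x.1, mul_nonneg hc ((halg h).1 _), fun b => ?_⟩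
    simp only [histP, heq]
    ring

lemma sum_optValue_succ_hist (halg : IsAlg n alg) (t T : ℕ) (w : Fin n → ℝ) :
    ∑ h : Fin (t + 1) → Fin n × Bool, optValue n Δ T (fun b => w b * histP n alg Δ b (hist h)) =
      ∑ h : Fin t → Fin n × Bool, ∑ a, alg (hist h) a *
        ∑ r : Bool, optValue n Δ T (fun b => w b * histP n alg Δ b (hist h) * rewP n Δ b a r) := by
  rw [sum_hist_succ t (fun h => optValue n Δ T (fun b => w b * histP n alg Δ b h))]
  refine Finset.sum_congr rfl fun h _ => Finset.sum_congr rfl fun a _ => ?_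
  rw [Finset.mul_sum]
  refine Finset.sum_congr rfl fun r _ => ?_
  rw [← optValue_smul T ((halg _).1 a)]
  congr 1
  ext b
  simp only [histP]
  ring

lemma sum_optValue_hist_le (halg : IsAlg n alg) (t T : ℕ) (w : Fin n → ℝ) :
    ∑ h : Fin t → Fin n × Bool, optValue n Δ T (fun b => w b * histP n alg Δ b (hist h)) ≤
      optValue n Δ (t + T) w := by
  induction t generalizing T with
  | zero =>
    rw [sum_hist_zero (fun h => optValue n Δ T (fun b => w b * histP n alg Δ b h))]
    simp [histP]
  | succ t ih =>
    rw [sum_optValue_succ_hist halg, show t + 1 + T = t + (T + 1) by ring]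
    refine le_trans (Finset.sum_le_sum fun h _ => ?_) (ih (T + 1))
    refine le_trans (Finset.sum_le_sum fun a _ =>
      mul_le_mul_of_nonneg_left (le_optValue_succ T _ a) ((halg _).1 a)) ?_
    rw [← Finset.sum_mul, (halg _).2, one_mul]

lemma achievableKernel_algKernel (h0 : 0 ≤ Δ) (h1 : Δ ≤ 1) (halg : IsAlg n alg) (t : ℕ) :
    AchievableKernel n Δ t (algKernel n t alg Δ) := by
  intro T S hS w hw
  refine le_trans ?_ (sum_optValue_hist_le halg t T w)
  calc ∑ b, w b * ∑ a, algKernel n t alg Δ b a * S a b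
      = ∑ b, ∑ a, ∑ h : Fin t → Fin n × Bool,
          alg (hist h) a * (w b * histP n alg Δ b (hist h) * S a b) := by
        refine Finset.sum_congr rfl fun b _ => ?_
        rw [Finset.mul_sum]
        refine Finset.sum_congr rfl fun a _ => ?_
        rw [algKernel, Finset.sum_mul, Finset.mul_sum]
        exact Finset.sum_congr rfl fun h _ => by ring
    _ = ∑ h : Fin t → Fin n × Bool, ∑ a,
          alg (hist h) a * ∑ b, w b * histP n alg Δ b (hist h) * S a b := by
        simp only [Finset.mul_sum]
        rw [Finset.sum_comm, Finset.sum_comm (γ := Fin t → Fin n × Bool)]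
        exact Finset.sum_congr rfl fun a _ => Finset.sum_comm
    _ ≤ _ := Finset.sum_le_sum fun h _ => by
        refine le_trans (Finset.sum_le_sum fun a _ => mul_le_mul_of_nonneg_left
          (hS a _ fun b => mul_nonneg (hw b) (histP_nonneg h0 h1 halg b _)) ((halg _).1 a)) ?_
        rw [← Finset.sum_mul, (halg _).2, one_mul]

lemma succProb_le_optValue (halg : IsAlg n alg) (t : ℕ) :
    succProb n t alg Δ ≤ (n : ℝ)⁻¹ * optValue n Δ t (fun _ => 1) := by
  refine mul_le_mul_of_nonneg_left ?_ (by positivity)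
  have h := sum_optValue_hist_le (Δ := Δ) halg t 0 (fun _ => 1)
  refine le_trans ?_ h
  rw [Finset.sum_comm]
  refine Finset.sum_le_sum fun h _ => ?_
  simp only [one_mul]
  calc ∑ b, histP n alg Δ b (hist h) * alg (hist h) b
      ≤ ∑ b, optValue n Δ 0 (fun b => histP n alg Δ b (hist h)) * alg (hist h) b :=
        Finset.sum_le_sum fun b _ => mul_le_mul_of_nonneg_right
          (le_optValue_zero (fun b => histP n alg Δ b (hist h)) b) ((halg _).1 b)
    _ = _ := by rw [← Finset.mul_sum, (halg _).2, mul_one]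

lemma exists_alg_succProb_eq [NeZero n] (t : ℕ) :
    ∃ alg, IsAlg n alg ∧ succProb n t alg Δ = (n : ℝ)⁻¹ * optValue n Δ t (fun _ => 1) := by
  obtain ⟨best, hbest0, hbest⟩ := exists_maximizer (n := n) (Δ := Δ)
  let alg : List (Fin n × Bool) → Fin n → ℝ := fun h a =>
    if a = best (t - h.length) (fun b => histP n (fun _ _ => 1) Δ b h) then 1 else 0
  have halg : IsAlg n alg := fun h =>
    ⟨fun a => by simp only [alg]; split_ifs <;> norm_num, by simp [alg]⟩
  have hchain : ∀ s T : ℕ, s + T = t → ∑ h : Fin s → Fin n × Bool,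
      optValue n Δ T (fun b => 1 * histP n alg Δ b (hist h)) = optValue n Δ t (fun _ => 1) := by
    intro s
    induction s with
    | zero =>
      intro T hT
      rw [sum_hist_zero (fun h => optValue n Δ T (fun b => 1 * histP n alg Δ b h))]
      simp [histP, ← hT]
    | succ s ih =>
      intro T hT
      rw [← ih (T + 1) (by omega), sum_optValue_succ_hist halg s T (fun _ => 1)]
      refine Finset.sum_congr rfl fun h _ => ?_
      obtain ⟨c, hc, heq⟩ := exists_histP_eq (Δ := Δ) halg (hist h)
      simp only [alg, length_hist, show t - s = T + 1 by omega, ite_mul, one_mul, zero_mul,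
        Finset.sum_ite_eq', Finset.mem_univ, if_true]
      change ∑ r : Bool, optValue n Δ T (fun b => histP n alg Δ b (hist h) * rewP n Δ b _ r) =
        optValue n Δ (T + 1) (fun b => histP n alg Δ b (hist h))
      simp only [heq, mul_assoc, optValue_smul _ hc, ← Finset.mul_sum]
      rw [hbest]
  refine ⟨alg, halg, ?_⟩
  rw [succProb, Finset.sum_comm, ← hchain t 0 rfl]
  congr 1
  refine Finset.sum_congr rfl fun h _ => ?_
  obtain ⟨c, hc, heq⟩ := exists_histP_eq (Δ := Δ) halg (hist h)
  simp only [one_mul, heq, optValue_smul _ hc, hbest0]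
  simp only [alg, length_hist, Nat.sub_self, mul_ite, mul_one, mul_zero, Finset.sum_ite_eq',
    Finset.mem_univ, if_true]

lemma pStar_eq_optValue [NeZero n] (t : ℕ) :
    pStar n t Δ = (n : ℝ)⁻¹ * optValue n Δ t (fun _ => 1) := by
  refine IsGreatest.csSup_eq ⟨?_, ?_⟩
  · obtain ⟨alg, halg, h⟩ := exists_alg_succProb_eq (n := n) (Δ := Δ) t
    exact ⟨alg, halg, h.symm⟩
  · rintro x ⟨alg, halg, rfl⟩
    exact succProb_le_optValue halg t

end Histories

section Achievable

variable {n : ℕ} {Δ : ℝ}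

lemma Achievable.mono {T : ℕ} {S S' : Fin n → ℝ} (hS : Achievable n Δ T S)
    (h : ∀ b, S' b ≤ S b) : Achievable n Δ T S' := fun w hw =>
  le_trans (Finset.sum_le_sum fun b _ => mul_le_mul_of_nonneg_left (h b) (hw b)) (hS w hw)

lemma Achievable.pull (h0 : 0 ≤ Δ) (h1 : Δ ≤ 1) {T : ℕ} {S : Bool → Fin n → ℝ}
    (hS : ∀ r, Achievable n Δ T (S r)) (a : Fin n) :
    Achievable n Δ (T + 1) (fun b => ∑ r : Bool, rewP n Δ b a r * S r b) := by
  intro w hw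
  refine le_trans ?_ (le_optValue_succ T w a)
  simp only [Finset.mul_sum]
  rw [Finset.sum_comm]
  refine Finset.sum_le_sum fun r _ => ?_
  simp only [← mul_assoc]
  exact hS r _ fun b => mul_nonneg (hw b) (rewP_nonneg h0 h1 b a r)

lemma achievable_single (h0 : 0 ≤ Δ) (h1 : Δ ≤ 1) (T : ℕ) (a : Fin n) :
    Achievable n Δ T (fun b => if b = a then 1 else 0) := by
  induction T with
  | zero => exact fun w _ => by simpa using le_optValue_zero w a
  | succ T ih =>
    refine (Achievable.pull h0 h1 (fun _ => ih) a).mono fun b => ?_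
    rw [← Finset.sum_mul, sum_rewP, one_mul]

lemma achievable_zero [NeZero n] (h0 : 0 ≤ Δ) (h1 : Δ ≤ 1) (T : ℕ) :
    Achievable n Δ T (fun _ => 0) :=
  (achievable_single h0 h1 T 0).mono fun b => by split_ifs <;> norm_num

lemma Achievable.perm {T : ℕ} {S : Fin n → ℝ} (hS : Achievable n Δ T S)
    (σ : Equiv.Perm (Fin n)) : Achievable n Δ T (fun b => S (σ b)) := by
  intro w hw
  rw [← optValue_perm T σ.symm w]
  refine le_trans (le_of_eq ?_) (hS _ fun b => hw _)
  rw [← Equiv.sum_comp σ (fun b => w (σ.symm b) * S b)]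
  simp

lemma Achievable.average [NeZero n] {T : ℕ} {S : Fin n → Fin n → ℝ}
    (hS : ∀ s, Achievable n Δ T (S s)) :
    Achievable n Δ T (fun b => (n : ℝ)⁻¹ * ∑ s, S s b) := by
  intro w hw
  have hn : (n : ℝ) ≠ 0 := NeZero.ne _
  calc ∑ b, w b * ((n : ℝ)⁻¹ * ∑ s, S s b) = (n : ℝ)⁻¹ * ∑ s, ∑ b, w b * S s b := by
        rw [Finset.sum_comm, Finset.mul_sum]
        refine Finset.sum_congr rfl fun b _ => ?_
        rw [← Finset.mul_sum]
        ring
    _ ≤ (n : ℝ)⁻¹ * ∑ _s : Fin n, optValue n Δ T w :=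
        mul_le_mul_of_nonneg_left (Finset.sum_le_sum fun s _ => hS s w hw) (by positivity)
    _ = optValue n Δ T w := by
        rw [Finset.sum_const, Finset.card_univ, Fintype.card_fin, nsmul_eq_mul,
          inv_mul_cancel_left₀ hn]

lemma AchievableKernel.perm {t : ℕ} {K : Fin n → Fin n → ℝ} (hK : AchievableKernel n Δ t K)
    (σ : Equiv.Perm (Fin n)) : AchievableKernel n Δ t (fun b a => K (σ b) (σ a)) := by
  intro T S hS
  refine ((hK T (fun a b => S (σ.symm a) (σ.symm b))
    fun a => (hS (σ.symm a)).perm σ.symm).perm σ).mono fun b => le_of_eq ?_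
  rw [← Equiv.sum_comp σ (fun a => K (σ b) a * S (σ.symm a) (σ.symm (σ b)))]
  simp

lemma AchievableKernel.average [NeZero n] {t : ℕ} {K : Fin n → Fin n → Fin n → ℝ}
    (hK : ∀ s, AchievableKernel n Δ t (K s)) :
    AchievableKernel n Δ t (fun b a => (n : ℝ)⁻¹ * ∑ s, K s b a) := by
  intro T S hS
  refine (Achievable.average fun s => hK s T S hS).mono fun b => le_of_eq ?_
  rw [Finset.sum_comm, Finset.mul_sum]
  refine Finset.sum_congr rfl fun a _ => ?_
  rw [← Finset.sum_mul]
  ring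

/-- An optimal algorithm, averaged over cyclic relabelings of the arms, proposes the best arm with
probability `pStar`, whichever arm is the best one. -/
lemma exists_symmetric_kernel [NeZero n] (h0 : 0 ≤ Δ) (h1 : Δ ≤ 1) (t : ℕ) :
    0 ≤ pStar n t Δ ∧ pStar n t Δ ≤ 1 ∧ ∃ K : Fin n → Fin n → ℝ, AchievableKernel n Δ t K ∧
      (∀ b, ∑ a, K b a = 1) ∧ ∀ b, K b b = pStar n t Δ := by
  obtain ⟨alg, halg, hp⟩ := exists_alg_succProb_eq (n := n) (Δ := Δ) t
  rw [← pStar_eq_optValue, succProb_eq] at hp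
  have hn : (n : ℝ) ≠ 0 := NeZero.ne _
  have hnonneg : ∀ b a, 0 ≤ algKernel n t alg Δ b a := fun b a =>
    Finset.sum_nonneg fun h _ => mul_nonneg (histP_nonneg h0 h1 halg b _) ((halg _).1 a)
  have hK := achievableKernel_algKernel h0 h1 halg t
  refine ⟨?_, ?_, _, AchievableKernel.average fun s => hK.perm (Equiv.addRight s), ?_, ?_⟩
  · rw [← hp]
    exact mul_nonneg (by positivity) (Finset.sum_nonneg fun b _ => hnonneg b b)
  · rw [← hp]
    have hle : ∑ b, algKernel n t alg Δ b b ≤ ∑ _b : Fin n, (1 : ℝ) :=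
      Finset.sum_le_sum fun b _ => by
        rw [← sum_algKernel (Δ := Δ) halg t b]
        exact Finset.single_le_sum (fun a _ => hnonneg b a) (Finset.mem_univ b)
    have := mul_le_mul_of_nonneg_left hle (inv_nonneg.2 (Nat.cast_nonneg (α := ℝ) n))
    simpa [hn] using this
  · intro b
    rw [← Finset.mul_sum, Finset.sum_comm]
    have : ∀ s : Fin n, ∑ a, algKernel n t alg Δ (Equiv.addRight s b) (Equiv.addRight s a) = 1 :=
      fun s => by
        rw [Equiv.sum_comp (Equiv.addRight s) (fun a => algKernel n t alg Δ (Equiv.addRight s b) a),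
          sum_algKernel halg]
    simp only [this]
    simp [hn]
  · intro b
    rw [← hp]
    congr 1
    exact Equiv.sum_comp (Equiv.addLeft b) (fun a => algKernel n t alg Δ a a)

end Achievable

section Boosting

/-- Success probability guaranteed with `j` proposals left and `u` test pulls left out of `B`, when
a proposal is correct with probability `p`, a correct proposal survives its test with probability
at least `q`, and testing a wrong proposal takes `τ` pulls on average. -/
def boostBound (p q τ B : ℝ) (j : ℕ) (u : ℝ) : ℝ :=
  ∑ i ∈ Finset.range j, q / B * (p * (1 - p) ^ i * (u - i * τ))

lemma boostBound_succ (p q τ B : ℝ) (j : ℕ) (u : ℝ) :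
    boostBound p q τ B (j + 1) u =
      p * (q * (u / B)) + (1 - p) * boostBound p q τ B j (u - τ) := by
  rw [boostBound, Finset.sum_range_succ', boostBound, Finset.mul_sum, add_comm]
  congr 1
  · simp; ring
  · refine Finset.sum_congr rfl fun i _ => ?_
    push_cast
    ring

lemma boostBound_affine (p q τ B : ℝ) (j : ℕ) (α u v : ℝ) :
    boostBound p q τ B j (α * u + (1 - α) * v) =
      α * boostBound p q τ B j u + (1 - α) * boostBound p q τ B j v := by
  simp only [boostBound, Finset.mul_sum, ← Finset.sum_add_distrib]
  exact Finset.sum_congr rfl fun i _ => by ring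

lemma boostBound_nonpos {p q τ B : ℝ} (hp0 : 0 ≤ p) (hp1 : p ≤ 1) (hq : 0 ≤ q) (hτ : 0 ≤ τ)
    (hB : 0 ≤ B) (j : ℕ) {u : ℝ} (hu : u ≤ 0) : boostBound p q τ B j u ≤ 0 := by
  refine Finset.sum_nonpos fun i _ => mul_nonpos_of_nonneg_of_nonpos (by positivity) ?_
  have : 0 ≤ 1 - p := by linarith
  refine mul_nonpos_of_nonneg_of_nonpos (by positivity) ?_
  have : 0 ≤ i * τ := by positivity
  linarith

lemma half_sum_geom_le {p : ℝ} (hp0 : 0 ≤ p) (hp1 : p ≤ 1) (m : ℕ) :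
    (1 - (1 - p) ^ m) / 2 ≤ ∑ i ∈ Finset.range m, p * (1 - p) ^ i * (1 - i / m) := by
  rcases Nat.eq_zero_or_pos m with rfl | hm
  · simp
  have hm' : (0 : ℝ) < m := by exact_mod_cast hm
  have hf : Antitone fun i : ℕ => p * (1 - p) ^ i := fun i j hij =>
    mul_le_mul_of_nonneg_left
      (pow_le_pow_of_le_one (by linarith) (by linarith) hij) hp0
  have hg : Antitone fun i : ℕ => 1 - (i : ℝ) / m := fun i j hij => by
    have : (i : ℝ) ≤ j := by exact_mod_cast hij
    have := div_le_div_of_nonneg_right this hm'.le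
    simp only
    linarith
  have hcheb := (hf.monovary hg).monovaryOn (Finset.range m : Set ℕ) |>.sum_mul_sum_le_card_mul_sum
  have hgeom : ∑ i ∈ Finset.range m, p * (1 - p) ^ i = 1 - (1 - p) ^ m := by
    have := geom_sum_mul (1 - p) m
    rw [← Finset.mul_sum]
    linarith
  have hlin : (m : ℝ) / 2 ≤ ∑ i ∈ Finset.range m, (1 - (i : ℝ) / m) := by
    have hgauss : ∀ k : ℕ, ∑ i ∈ Finset.range k, (i : ℝ) = k * (k - 1) / 2 := by
      intro k
      induction k with
      | zero => simp
      | succ k ih => rw [Finset.sum_range_succ, ih]; push_cast; ring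
    rw [Finset.sum_sub_distrib, ← Finset.sum_div, hgauss]
    simp only [Finset.sum_const, Finset.card_range, nsmul_eq_mul, mul_one]
    have : (m : ℝ) * (m - 1) / 2 / m = (m - 1) / 2 := by field_simp
    rw [this]
    linarith
  rw [hgeom, Finset.card_range] at hcheb
  have hpow : 0 ≤ 1 - (1 - p) ^ m := by
    have := pow_le_one₀ (n := m) (show 0 ≤ 1 - p by linarith) (by linarith)
    linarith
  have := mul_le_mul_of_nonneg_left hlin hpow
  refine le_of_mul_le_mul_left ?_ hm'
  linarith

variable {n : ℕ} {Δ : ℝ}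

/-- Testing arm `a` by a random walk started at `x` and moving up or down with the rewards: the
arm is kept as long as the walk stays positive, and abandoned when it hits `0`. -/
lemma achievable_test [NeZero n] (h0 : 0 < Δ) (h1 : Δ ≤ 1) {p q τ B : ℝ} (hp0 : 0 ≤ p)
    (hp1 : p ≤ 1) (hq : 0 ≤ q) (hτ : 0 ≤ τ) (hB : 0 ≤ B) {j s : ℕ}
    (hnext : ∀ T : ℕ, (T : ℝ) ≤ B →
      Achievable n Δ (T + s) (fun _ => boostBound p q τ B j T))
    (a : Fin n) (T : ℕ) (hT : (T : ℝ) ≤ B) (x : ℕ) :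
    Achievable n Δ (T + s) (fun b => if b = a then 1 - ((1 - Δ) / (1 + Δ)) ^ x
      else boostBound p q τ B j (T - x / Δ)) := by
  have hρ : 0 ≤ (1 - Δ) / (1 + Δ) := div_nonneg (by linarith) (by linarith)
  induction T generalizing x with
  | zero =>
    refine (achievable_single h0.le h1 (0 + s) a).mono fun b => ?_
    split_ifs
    · linarith [pow_nonneg hρ x]
    · refine boostBound_nonpos hp0 hp1 hq hτ hB j ?_
      have : 0 ≤ (x : ℝ) / Δ := by positivity
      push_cast
      linarith
  | succ T ih =>
    cases x with
    | zero =>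
      rcases le_total 0 (boostBound p q τ B j ((T + 1 : ℕ) : ℝ)) with h | h
      · refine (hnext _ hT).mono fun b => ?_
        split_ifs
        · simpa using h
        · simp
      · refine (achievable_zero h0.le h1 _).mono fun b => ?_
        split_ifs
        · simp
        · simpa using h
    | succ x =>
      have hT' : (T : ℝ) ≤ B := by push_cast at hT; linarith
      have hpull := Achievable.pull h0.le h1
        (S := fun r b => if b = a then 1 - ((1 - Δ) / (1 + Δ)) ^ (if r then x + 2 else x)
          else boostBound p q τ B j (T - ((if r then x + 2 else x : ℕ) : ℝ) / Δ))
        (fun r => ih hT' _) a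
      rw [show T + 1 + s = T + s + 1 by ring]
      refine hpull.mono fun b => le_of_eq ?_
      by_cases hb : b = a
      · have : 1 + Δ ≠ 0 := by linarith
        simp only [hb, rewP, Fintype.sum_bool, if_true, Bool.false_eq_true, if_false]
        have hfix : (1 + Δ) * ((1 - Δ) / (1 + Δ)) = 1 - Δ := mul_div_cancel₀ _ this
        generalize (1 - Δ) / (1 + Δ) = ρ at hfix
        linear_combination ρ ^ x * (ρ / 2 - 1 / 2) * hfix
      · have hb' : ¬ a = b := fun h => hb h.symm
        simp only [hb, hb', rewP, Fintype.sum_bool, if_true, Bool.false_eq_true, if_false]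
        rw [← boostBound_affine]
        congr 1
        push_cast
        field_simp
        ring

lemma achievable_boost [NeZero n] (h0 : 0 < Δ) (h1 : Δ ≤ 1) (t k : ℕ) {q B : ℝ} (hq0 : 0 ≤ q)
    (hq : q ≤ 1 - ((1 - Δ) / (1 + Δ)) ^ k) (hB : 0 ≤ B) (j T : ℕ) (hT : (T : ℝ) ≤ B) :
    Achievable n Δ (T + j * t) (fun _ => boostBound (pStar n t Δ) q (k / Δ) B j T) := by
  obtain ⟨hp0, hp1, K, hK, hKsum, hKdiag⟩ := exists_symmetric_kernel (n := n) h0.le h1 t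
  induction j generalizing T with
  | zero =>
    refine (achievable_zero h0.le h1 _).mono fun b => ?_
    simp [boostBound]
  | succ j ih =>
    have htest := fun a => achievable_test h0 h1 hp0 hp1 hq0
      (show 0 ≤ (k : ℝ) / Δ by positivity) hB ih a T hT k
    rw [show T + (j + 1) * t = t + (T + j * t) by ring]
    refine (hK _ _ htest).mono fun b => ?_
    rw [boostBound_succ]
    set W := boostBound (pStar n t Δ) q (k / Δ) B j (T - k / Δ)
    have hsum : ∑ a, K b a * (if b = a then 1 - ((1 - Δ) / (1 + Δ)) ^ k else W) =
        pStar n t Δ * (1 - ((1 - Δ) / (1 + Δ)) ^ k) + (1 - pStar n t Δ) * W := by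
      have : ∀ a, K b a * (if b = a then 1 - ((1 - Δ) / (1 + Δ)) ^ k else W) =
          K b a * W + if b = a then K b a * (1 - ((1 - Δ) / (1 + Δ)) ^ k - W) else 0 := by
        intro a
        split_ifs <;> ring
      simp only [this, Finset.sum_add_distrib, ← Finset.sum_mul, hKsum, Finset.sum_ite_eq,
        Finset.mem_univ, if_true, hKdiag]
      ring
    rw [hsum]
    have hTB : (T : ℝ) / B ≤ 1 := div_le_one_of_le₀ hT hB
    have : q * (T / B) ≤ 1 - ((1 - Δ) / (1 + Δ)) ^ k :=
      (mul_le_of_le_one_right hq0 hTB).trans hq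
    linarith [mul_le_mul_of_nonneg_left this hp0]

lemma pow_floor_inv_le_half (h0 : 0 < Δ) (h1 : Δ < 1) :
    ((1 - Δ) / (1 + Δ)) ^ ⌊1 / Δ⌋₊ ≤ 1 / 2 := by
  set k := ⌊1 / Δ⌋₊
  have hinv : 1 < 1 / Δ := by rwa [lt_div_iff₀ h0, one_mul]
  have hk1 : (1 : ℝ) ≤ k := by exact_mod_cast (Nat.one_le_floor_iff _).2 hinv.le
  have hk2 : 1 / Δ < k + 1 := Nat.lt_floor_add_one _
  have hkΔ : 1 ≤ 2 * (k * Δ) := by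
    rw [div_lt_iff₀ h0] at hk2
    nlinarith
  have hbern : 1 + (k : ℝ) * (2 * Δ / (1 - Δ)) ≤ (1 + 2 * Δ / (1 - Δ)) ^ k :=
    one_add_mul_le_pow (by
      have : 0 ≤ 2 * Δ / (1 - Δ) := div_nonneg (by linarith) (by linarith)
      linarith) k
  have h1' : 0 < 1 - Δ := by linarith
  have hge : 2 * Δ ≤ 2 * Δ / (1 - Δ) := by
    rw [le_div_iff₀ h1']
    nlinarith
  have htwo : (2 : ℝ) ≤ (1 + 2 * Δ / (1 - Δ)) ^ k := by nlinarith
  have heq : (1 - Δ) / (1 + Δ) = (1 + 2 * Δ / (1 - Δ))⁻¹ := by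
    have : 1 + Δ ≠ 0 := by linarith
    field_simp
    ring
  rw [heq, inv_pow, one_div]
  exact inv_anti₀ two_pos htwo

lemma quarter_le_boostBound {p : ℝ} (hp0 : 0 ≤ p) (hp1 : p ≤ 1) (h0 : 0 < Δ) {B : ℝ} {m : ℕ}
    (hB : m / Δ ^ 2 ≤ B) :
    1 / 4 * (1 - (1 - p) ^ m) ≤ boostBound p (1 / 2) (⌊1 / Δ⌋₊ / Δ) B m B := by
  have hhalf := half_sum_geom_le hp0 hp1 m
  suffices h : ∑ i ∈ Finset.range m, p * (1 - p) ^ i * (1 - i / m) / 2 ≤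
      boostBound p (1 / 2) (⌊1 / Δ⌋₊ / Δ) B m B by
    rw [← Finset.sum_div] at h
    linarith
  refine Finset.sum_le_sum fun i hi => ?_
  have hm : (0 : ℝ) < m := by exact_mod_cast lt_of_le_of_lt (Nat.zero_le i) (Finset.mem_range.1 hi)
  have hBpos : 0 < B := lt_of_lt_of_le (by positivity) hB
  have hk : (⌊1 / Δ⌋₊ : ℝ) / Δ ≤ 1 / Δ ^ 2 := by
    have := Nat.floor_le (show 0 ≤ 1 / Δ by positivity)
    calc (⌊1 / Δ⌋₊ : ℝ) / Δ ≤ 1 / Δ / Δ := div_le_div_of_nonneg_right this h0.le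
      _ = 1 / Δ ^ 2 := by field_simp
  have hfrac : (i : ℝ) * (⌊1 / Δ⌋₊ / Δ) / B ≤ i / m := by
    rw [div_le_div_iff₀ hBpos hm]
    calc (i : ℝ) * (⌊1 / Δ⌋₊ / Δ) * m ≤ i * (1 / Δ ^ 2) * m := by gcongr
      _ = i * (m / Δ ^ 2) := by ring
      _ ≤ i * B := by gcongr
  have hcoef : 0 ≤ p * (1 - p) ^ i := mul_nonneg hp0 (pow_nonneg (by linarith) i)
  calc p * (1 - p) ^ i * (1 - i / m) / 2
      ≤ p * (1 - p) ^ i * (1 - (i : ℝ) * (⌊1 / Δ⌋₊ / Δ) / B) / 2 := by gcongr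
    _ = _ := by field_simp

end Boosting

/-- Boosting: for every `ε ∈ (0,1)` there is `c > 0` such that for all `n ≥ 2`,
`Δ ∈ (0, 1-ε]` and all integers `t, m ≥ 0`,
`p*_{m t + ⌈m/Δ²⌉} ≥ c (1 - (1 - p*_t)^m)`. -/
theorem bandit_boosting :
    ∀ ε : ℝ, ε ∈ Set.Ioo (0 : ℝ) 1 → ∃ c : ℝ, 0 < c ∧
      ∀ n : ℕ, 2 ≤ n → ∀ Δ : ℝ, Δ ∈ Set.Ioc (0 : ℝ) (1 - ε) →
        ∀ t m : ℕ,
          c * (1 - (1 - pStar n t Δ) ^ m) ≤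
            pStar n (m * t + ⌈(m : ℝ) / Δ ^ 2⌉₊) Δ := by
  intro ε hε
  refine ⟨1 / 4, by norm_num, fun n hn Δ hΔ t m => ?_⟩
  have : NeZero n := ⟨by omega⟩
  have hΔ0 : 0 < Δ := hΔ.1
  have hΔ1 : Δ < 1 := by linarith [hΔ.2, hε.1]
  obtain ⟨hp0, hp1, -⟩ := exists_symmetric_kernel (n := n) hΔ0.le hΔ1.le t
  have hboost := achievable_boost (n := n) hΔ0 hΔ1.le t ⌊1 / Δ⌋₊ (q := 1 / 2)
    (B := (⌈(m : ℝ) / Δ ^ 2⌉₊ : ℕ)) (by norm_num)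
    (by linarith [pow_floor_inv_le_half hΔ0 hΔ1]) (Nat.cast_nonneg _) m _ le_rfl
    (fun _ => 1) (fun _ => zero_le_one)
  refine (quarter_le_boostBound hp0 hp1 hΔ0 (Nat.le_ceil _)).trans ?_
  rw [pStar_eq_optValue (m * t + _), add_comm (m * t), ← div_eq_inv_mul,
    le_div_iff₀ (Nat.cast_pos.2 (by omega))]
  simpa [mul_comm] using hboost
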